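/- Let φ : ℝ² → ℝ be a smooth solution of the sine-Gordon equation ∂ₓ∂_yφ = sin φ, and let λ be a nonzero real number. Then there exists a unique smooth map U : ℝ² → M₂(ℂ) satisfying ∂ₓU(x,y) = U(x,y)·A_φ(x,y,λ), ∂_yU(x,y) = U(x,y)·B_φ(x,y,λ) for all (x,y) ∈ ℝ², with U(0,0) = I. Moreover U(x,y) ∈ SU(2) for all (x,y) ∈ ℝ². -/

import Mathlib

open Matrix Complex

attribute [local instance] Matrix.normedAddCommGroup Matrix.normedSpace

noncomputable section

/-- The Pauli matrix σ₃. -/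
def sigma3 : Matrix (Fin 2) (Fin 2) ℂ := !![1, 0; 0, -1]

/-- The matrix `A_φ(x,y,λ) = (i/2)·[[∂ₓφ, −λ], [−λ, −∂ₓφ]]` of the Lax system. -/
def Aphi (φ : ℝ → ℝ → ℝ) (lam : ℂ) (x y : ℝ) : Matrix (Fin 2) (Fin 2) ℂ :=
  (Complex.I / 2) •
    !![((deriv (fun x' => φ x' y) x : ℝ) : ℂ), -lam;
       -lam, -((deriv (fun x' => φ x' y) x : ℝ) : ℂ)]

/-- The matrix `B_φ(x,y,λ) = (i/2)·λ⁻¹·[[0, e^{−iφ}], [e^{iφ}, 0]]` of the Lax system. -/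
def Bphi (φ : ℝ → ℝ → ℝ) (lam : ℂ) (x y : ℝ) : Matrix (Fin 2) (Fin 2) ℂ :=
  (Complex.I / 2) • lam⁻¹ •
    !![0, Complex.exp (-Complex.I * ((φ x y : ℝ) : ℂ));
       Complex.exp (Complex.I * ((φ x y : ℝ) : ℂ)), 0]

/-- Membership in SU(2): unitary with determinant one. -/
def IsSU2 (g : Matrix (Fin 2) (Fin 2) ℂ) : Prop := g * gᴴ = 1 ∧ g.det = 1

/-- The bilinear pairing `⟨X,Y⟩ = −2·tr(X·Y)` on 2×2 complex matrices. -/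
def pairing (X Y : Matrix (Fin 2) (Fin 2) ℂ) : ℂ := -2 * (X * Y).trace

/-- `IsLaxSolution φ lam U` says that `U` is a smooth solution of the Lax system
`∂ₓU = U·A_φ(·,·,λ)`, `∂_yU = U·B_φ(·,·,λ)` with `U(0,0) = I`. -/
def IsLaxSolution (φ : ℝ → ℝ → ℝ) (lam : ℝ) (U : ℝ → ℝ → Matrix (Fin 2) (Fin 2) ℂ) : Prop :=
  ContDiff ℝ (⊤ : ℕ∞) (fun p : ℝ × ℝ => U p.1 p.2) ∧
  (∀ x y : ℝ,
    HasDerivAt (fun x' => U x' y) (U x y * Aphi φ (lam : ℂ) x y) x ∧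
    HasDerivAt (fun y' => U x y') (U x y * Bphi φ (lam : ℂ) x y) y) ∧
  U 0 0 = 1

open Set

theorem exists_linear_ode_solution {E : Type*} [NormedAddCommGroup E] [NormedSpace ℝ E]
    [CompleteSpace E] {T : ℝ → E →L[ℝ] E} (hT : Continuous T) (x₀ : E) :
    ∃ u : ℝ → E, u 0 = x₀ ∧ ∀ t, HasDerivAt u (T t (u t)) t := by
  set G : ℝ → ℝ := fun t => ∫ s in (0 : ℝ)..t, ‖T s‖ with hG
  have hGd : ∀ t, HasDerivAt G ‖T t‖ t := fun t =>
    (hT.norm.integral_hasStrictDerivAt 0 t).hasDerivAt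
  have hGc : Continuous G := continuous_iff_continuousAt.2 fun t => (hGd t).continuousAt
  set ω : ℝ → ℝ := fun t => Real.cosh (2 * G t) with hω
  have hωc : Continuous ω := Real.continuous_cosh.comp (continuous_const.mul hGc)
  have hω1 : ∀ t, 1 ≤ ω t := fun t => Real.one_le_cosh _
  have hω0 : ∀ t, 0 < ω t := fun t => Real.cosh_pos _
  have hint : ∀ t, ∫ s in (0 : ℝ)..t, ‖T s‖ * ω s = Real.sinh (2 * G t) / 2 := by
    intro t
    have hd : ∀ s ∈ uIcc 0 t,
        HasDerivAt (fun s => Real.sinh (2 * G s) / 2) (‖T s‖ * ω s) s := by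
      intro s _
      have := (((hGd s).const_mul 2).sinh).div_const 2
      exact this.congr_deriv (by simp only [hω]; ring)
    rw [intervalIntegral.integral_eq_sub_of_hasDerivAt hd
      ((hT.norm.mul hωc).intervalIntegrable _ _)]
    simp [hG]
  have hcont : ∀ v : BoundedContinuousFunction ℝ E, Continuous fun s => T s (ω s • v s) :=
    fun v => hT.clm_apply (hωc.smul v.continuous)
  have hest : ∀ (v : BoundedContinuousFunction ℝ E) (t : ℝ),
      ‖(ω t)⁻¹ • ∫ s in (0 : ℝ)..t, T s (ω s • v s)‖ ≤ 1 / 2 * ‖v‖ := by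
    intro v t
    have h1 : ‖∫ s in (0 : ℝ)..t, T s (ω s • v s)‖
        ≤ |∫ s in (0 : ℝ)..t, ‖v‖ * (‖T s‖ * ω s)| := by
      apply intervalIntegral.norm_integral_le_abs_of_norm_le
      · refine Filter.Eventually.of_forall fun s => ?_
        calc ‖T s (ω s • v s)‖ ≤ ‖T s‖ * ‖ω s • v s‖ := (T s).le_opNorm _
          _ = ‖T s‖ * (ω s * ‖v s‖) := by
            rw [norm_smul, Real.norm_of_nonneg (hω0 s).le]
          _ ≤ ‖T s‖ * (ω s * ‖v‖) := by
            have := v.norm_coe_le_norm s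
            have := (hω0 s).le
            gcongr
          _ = ‖v‖ * (‖T s‖ * ω s) := by ring
      · exact (continuous_const.mul (hT.norm.mul hωc)).intervalIntegrable _ _
    rw [intervalIntegral.integral_const_mul, hint, abs_mul, abs_of_nonneg (norm_nonneg v)] at h1
    have h2 : |Real.sinh (2 * G t) / 2| ≤ ω t / 2 := by
      rw [abs_div, abs_of_pos (two_pos : (0 : ℝ) < 2)]
      have : |Real.sinh (2 * G t)| ≤ ω t :=
        abs_le_of_sq_le_sq (by linarith [Real.cosh_sq (2 * G t)]) (hω0 t).le
      linarith
    rw [norm_smul, norm_inv, Real.norm_of_nonneg (hω0 t).le, inv_mul_le_iff₀ (hω0 t)]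
    calc _ ≤ _ := h1
      _ ≤ ‖v‖ * (ω t / 2) := by gcongr
      _ = _ := by ring
  have hprim : ∀ v : BoundedContinuousFunction ℝ E, Continuous fun t =>
      ∫ s in (0 : ℝ)..t, T s (ω s • v s) := fun v =>
    intervalIntegral.continuous_primitive (fun a b => (hcont v).intervalIntegrable a b) 0
  let Φ : BoundedContinuousFunction ℝ E → BoundedContinuousFunction ℝ E := fun v =>
    BoundedContinuousFunction.ofNormedAddCommGroup
      (fun t => (ω t)⁻¹ • x₀ + (ω t)⁻¹ • ∫ s in (0 : ℝ)..t, T s (ω s • v s))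
      (((hωc.inv₀ fun t => (hω0 t).ne').smul continuous_const).add
        ((hωc.inv₀ fun t => (hω0 t).ne').smul (hprim v)))
      (‖x₀‖ + 1 / 2 * ‖v‖) (by
        intro t
        refine (norm_add_le _ _).trans (add_le_add ?_ (hest v t))
        rw [norm_smul, norm_inv, Real.norm_of_nonneg (hω0 t).le]
        exact mul_le_of_le_one_left (norm_nonneg _) (inv_le_one_of_one_le₀ (hω1 t)))
  have hΦ : ContractingWith (1 / 2) Φ := by
    refine ⟨by norm_num, LipschitzWith.of_dist_le_mul fun v w => ?_⟩
    rw [dist_eq_norm, dist_eq_norm]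
    refine (BoundedContinuousFunction.norm_le (by positivity)).2 fun t => ?_
    have := hest (v - w) t
    have e : (Φ v - Φ w) t = (ω t)⁻¹ • ∫ s in (0 : ℝ)..t, T s (ω s • (v - w) s) := by
      simp only [BoundedContinuousFunction.coe_sub, Pi.sub_apply, smul_sub, map_sub]
      rw [intervalIntegral.integral_sub ((hcont v).intervalIntegrable _ _)
        ((hcont w).intervalIntegrable _ _)]
      simp [Φ, smul_sub]
    rw [e]
    simpa using this
  obtain ⟨v, hv⟩ : ∃ v, Φ v = v := ⟨_, hΦ.fixedPoint_isFixedPt⟩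
  have hu : ∀ t, ω t • v t = x₀ + ∫ s in (0 : ℝ)..t, T s (ω s • v s) := by
    intro t
    have : v t = (ω t)⁻¹ • x₀ + (ω t)⁻¹ • ∫ s in (0 : ℝ)..t, T s (ω s • v s) :=
      (DFunLike.congr_fun hv t).symm
    conv_lhs => rw [this]
    rw [smul_add, smul_inv_smul₀ (hω0 t).ne', smul_inv_smul₀ (hω0 t).ne']
  refine ⟨fun t => ω t • v t, by simp [hu 0], fun t => ?_⟩
  have := ((hcont v).integral_hasStrictDerivAt 0 t).hasDerivAt.const_add x₀
  exact this.congr_of_eventuallyEq (Filter.Eventually.of_forall hu)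

theorem linear_ode_solution_unique {E : Type*} [NormedAddCommGroup E] [NormedSpace ℝ E]
    {T : ℝ → E →L[ℝ] E} (hT : Continuous T) {u v : ℝ → E}
    (hu : ∀ t, HasDerivAt u (T t (u t)) t) (hv : ∀ t, HasDerivAt v (T t (v t)) t)
    (h0 : u 0 = v 0) : u = v := by
  funext t
  set R := |t| + 1
  obtain ⟨K, hK⟩ := isCompact_Icc.bddAbove_image (K := Icc (-R) R) hT.norm.continuousOn
  have hR : |t| < R := lt_add_one _
  refine ODE_solution_unique_of_mem_Ioo (v := fun t x => T t x) (s := fun _ => univ)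
    (K := K.toNNReal) (a := -R) (b := R) (t₀ := 0)
    (fun s hs => ?_) ⟨by linarith [abs_nonneg t], by linarith [abs_nonneg t]⟩
    (fun s _ => ⟨hu s, mem_univ _⟩) (fun s _ => ⟨hv s, mem_univ _⟩) h0 (abs_lt.1 hR)
  refine LipschitzWith.lipschitzOnWith ((T s).lipschitz.weaken ?_)
  exact NNReal.le_toNNReal_of_coe_le (hK ⟨s, Ioo_subset_Icc_self hs, rfl⟩)

/-- Pointwise application of an operator-valued function to a vector-valued one. -/
def pointwiseApplyCLM (K F : Type*) [TopologicalSpace K] [CompactSpace K]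
    [NormedAddCommGroup F] [NormedSpace ℝ F] :
    C(K, F →L[ℝ] F) →L[ℝ] C(K, F) →L[ℝ] C(K, F) :=
  LinearMap.mkContinuous₂
    (LinearMap.mk₂ ℝ (fun (f : C(K, F →L[ℝ] F)) (g : C(K, F)) =>
      (⟨fun x => f x (g x), f.continuous.clm_apply g.continuous⟩ : C(K, F)))
      (fun _ _ _ => by ext; simp) (fun _ _ _ => by ext; simp)
      (fun _ _ _ => by ext; simp) (fun _ _ _ => by ext; simp)) 1 (by
    intro f g
    refine (ContinuousMap.norm_le _ (by positivity)).2 fun x => ?_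
    rw [one_mul]
    exact ((f x).le_opNorm _).trans (mul_le_mul (f.norm_coe_le_norm x) (g.norm_coe_le_norm x)
      (norm_nonneg _) ((norm_nonneg _).trans (f.norm_coe_le_norm x))))

theorem continuous_comp_projIcc {F : Type*} [TopologicalSpace F] {R : ℝ} (hR : -R ≤ R) (w : C(Icc (-R) R, F)) :
    Continuous fun s => w (projIcc (-R) R hR s) :=
  w.continuous.comp continuous_projIcc

/-- The antiderivative on `[-R, R]` with prescribed value at `0`, as a bounded operator. -/
def antiderivCLM {F : Type*} [NormedAddCommGroup F] [NormedSpace ℝ F] {R : ℝ} (hR : -R ≤ R) :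
    F × C(Icc (-R) R, F) →L[ℝ] C(Icc (-R) R, F) :=
  LinearMap.mkContinuous
    { toFun := fun p => ⟨fun x => p.1 + ∫ s in (0 : ℝ)..x, p.2 (projIcc (-R) R hR s),
        continuous_const.add ((intervalIntegral.continuous_primitive
          (fun a b => (continuous_comp_projIcc hR p.2).intervalIntegrable a b) 0).comp
            continuous_subtype_val)⟩
      map_add' := fun p q => by
        ext x
        simp only [Prod.fst_add, Prod.snd_add, ContinuousMap.add_apply, ContinuousMap.coe_mk]
        rw [intervalIntegral.integral_add
          ((continuous_comp_projIcc hR p.2).intervalIntegrable _ _)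
          ((continuous_comp_projIcc hR q.2).intervalIntegrable _ _)]
        abel
      map_smul' := fun a p => by
        ext x
        simp [intervalIntegral.integral_smul] } (1 + R) (by
    intro p
    have hR0 : 0 ≤ R := by linarith
    refine (ContinuousMap.norm_le _ (by positivity)).2 fun x => ?_
    have h1 : ‖∫ s in (0 : ℝ)..x, p.2 (projIcc (-R) R hR s)‖ ≤ ‖p.2‖ * |(x : ℝ) - 0| :=
      intervalIntegral.norm_integral_le_of_norm_le_const fun s _ => p.2.norm_coe_le_norm _
    have h2 : |(x : ℝ) - 0| ≤ R := by rw [sub_zero]; exact abs_le.2 x.2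
    calc ‖p.1 + ∫ s in (0 : ℝ)..x, p.2 (projIcc (-R) R hR s)‖
        ≤ ‖p.1‖ + ‖p.2‖ * R := (norm_add_le _ _).trans (by gcongr; exact h1.trans (by gcongr))
      _ ≤ ‖p‖ + ‖p‖ * R := by
        have h3 := norm_fst_le p
        have h4 := norm_snd_le p
        gcongr
      _ = (1 + R) * ‖p‖ := by ring)

section

variable {F : Type*} [NormedAddCommGroup F] [NormedSpace ℝ F]
  {A B Ay Bx : ℝ → ℝ → F →L[ℝ] F}

theorem exists_local_frobenius_solution [CompleteSpace F]
    (hA : Continuous fun p : ℝ × ℝ => A p.1 p.2) (hB : Continuous fun p : ℝ × ℝ => B p.1 p.2)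
    (hBxc : Continuous fun p : ℝ × ℝ => Bx p.1 p.2)
    (hAy : ∀ x y, HasDerivAt (A x) (Ay x y) y)
    (hBx : ∀ x y, HasDerivAt (fun x' => B x' y) (Bx x y) x)
    (hcompat : ∀ x y, Ay x y + A x y * B x y = Bx x y + B x y * A x y)
    {V : ℝ → F} (hV : ∀ x, HasDerivAt V (A x 0 (V x)) x) {R : ℝ} (hR : 0 ≤ R) :
    ∃ U : ℝ → ℝ → F, (Continuous fun p : ℝ × ℝ => U p.1 p.2) ∧
      ∀ x ∈ Icc (-R) R, U x 0 = V x ∧ ∀ y,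
        HasDerivAt (fun x' => U x' y) (A x y (U x y)) x ∧
        HasDerivAt (U x) (B x y (U x y)) y := by
  have hR' : -R ≤ R := by linarith
  have h0 : (0 : ℝ) ∈ Icc (-R) R := ⟨by linarith, hR⟩
  have hVc : Continuous V := continuous_iff_continuousAt.2 fun x => (hV x).continuousAt
  have hAVc : Continuous fun s => A s 0 (V s) :=
    (hA.comp (continuous_id.prodMk continuous_const)).clm_apply hVc
  let curryIcc : ∀ f : ℝ → ℝ → F →L[ℝ] F, Continuous (fun p : ℝ × ℝ => f p.1 p.2) →
      C(ℝ, C(Icc (-R) R, F →L[ℝ] F)) := fun f hf =>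
    ContinuousMap.curry ⟨fun p : ℝ × Icc (-R) R => f p.2 p.1,
      hf.comp ((continuous_subtype_val.comp continuous_snd).prodMk continuous_fst)⟩
  let T : ℝ → (F × C(Icc (-R) R, F)) →L[ℝ] (F × C(Icc (-R) R, F)) := fun y =>
    ((B 0 y).comp (ContinuousLinearMap.fst ℝ _ _)).prod
      ((pointwiseApplyCLM _ _ (curryIcc B hB y)).comp (ContinuousLinearMap.snd ℝ _ _) +
        (pointwiseApplyCLM _ _ (curryIcc Bx hBxc y)).comp (antiderivCLM hR'))
  have hT : Continuous T := by
    have h1 : Continuous fun y => B 0 y := hB.comp (continuous_const.prodMk continuous_id)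
    have h2 : Continuous fun y => pointwiseApplyCLM _ _ (curryIcc B hB y) :=
      (pointwiseApplyCLM _ _).continuous.comp (curryIcc B hB).continuous
    have h3 : Continuous fun y => pointwiseApplyCLM _ _ (curryIcc Bx hBxc y) :=
      (pointwiseApplyCLM _ _).continuous.comp (curryIcc Bx hBxc).continuous
    exact (ContinuousLinearMap.prodₗᵢ ℝ).continuous.comp
      ((h1.clm_comp continuous_const).prodMk
        ((h2.clm_comp continuous_const).add (h3.clm_comp continuous_const)))
  obtain ⟨u, hu0, hu⟩ := exists_linear_ode_solution hT
    (V 0, (⟨fun s => A s 0 (V s), hAVc.comp continuous_subtype_val⟩ : C(Icc (-R) R, F)))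
  have huc : Continuous u := continuous_iff_continuousAt.2 fun y => (hu y).continuousAt
  set w : ℝ → ℝ → F := fun y s => (u y).2 (projIcc (-R) R hR' s) with hw
  have hwc : Continuous fun p : ℝ × ℝ => w p.1 p.2 :=
    (continuous_snd.comp (huc.comp continuous_fst)).eval
      (continuous_projIcc.comp continuous_snd)
  set U : ℝ → ℝ → F := fun x y => (u y).1 + ∫ s in (0 : ℝ)..x, w y s with hU
  have hUc : Continuous fun p : ℝ × ℝ => U p.1 p.2 := by
    refine (continuous_fst.comp (huc.comp continuous_snd)).add ?_
    exact intervalIntegral.continuous_parametric_intervalIntegral_of_continuous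
      (f := fun (p : ℝ × ℝ) s => w p.2 s)
      (hwc.comp ((continuous_snd.comp continuous_fst).prodMk continuous_snd)) continuous_fst
  have hUx : ∀ x y, HasDerivAt (fun x' => U x' y) (w y x) x := fun x y =>
    ((hwc.comp (continuous_const.prodMk continuous_id)).integral_hasStrictDerivAt
      0 x).hasDerivAt.const_add _
  have hproj : ∀ {x}, x ∈ Icc (-R) R → ∀ {s}, s ∈ uIcc 0 x → ∃ h : s ∈ Icc (-R) R,
      projIcc (-R) R hR' s = ⟨s, h⟩ := fun hx s hs =>
    have h : s ∈ Icc (-R) R := uIcc_subset_Icc h0 hx hs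
    ⟨h, projIcc_of_mem _ h⟩
  have hUy : ∀ x ∈ Icc (-R) R, ∀ y, HasDerivAt (U x) (B x y (U x y)) y := by
    intro x hx y
    have h1 := ((ContinuousMap.evalCLM ℝ (⟨x, hx⟩ : Icc (-R) R)).comp
      (antiderivCLM hR')).hasFDerivAt.comp_hasDerivAt y (hu y)
    refine h1.congr_deriv ?_
    change B 0 y (u y).1 + ∫ s in (0 : ℝ)..x, (T y (u y)).2 (projIcc (-R) R hR' s) = _
    have h2 : ∀ s ∈ uIcc 0 x, (T y (u y)).2 (projIcc (-R) R hR' s)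
        = Bx s y (U s y) + B s y (w y s) := by
      intro s hs
      obtain ⟨h, hp⟩ := hproj hx hs
      simp only [hw, hp]
      exact add_comm _ _
    rw [intervalIntegral.integral_congr h2,
      intervalIntegral.integral_eq_sub_of_hasDerivAt
        (fun s _ => (hBx s y).clm_apply (hUx s y))]
    · simp [hU]
    · have hc : Continuous fun s : ℝ => (s, y) := continuous_id.prodMk continuous_const
      exact (((hBxc.comp hc).clm_apply (hUc.comp hc)).add ((hB.comp hc).clm_apply
        (hwc.comp (continuous_const.prodMk continuous_id)))).intervalIntegrable _ _
  have hU0 : ∀ x ∈ Icc (-R) R, U x 0 = V x := by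
    intro x hx
    have h2 : ∀ s ∈ uIcc 0 x, w 0 s = A s 0 (V s) := by
      intro s hs
      obtain ⟨h, hp⟩ := hproj hx hs
      simp only [hw, hp, hu0]
      rfl
    simp only [hU]
    rw [intervalIntegral.integral_congr h2,
      intervalIntegral.integral_eq_sub_of_hasDerivAt (fun s _ => hV s)
        (hAVc.intervalIntegrable _ _), hu0]
    simp
  have hwA : ∀ x ∈ Icc (-R) R, ∀ y, w y x = A x y (U x y) := by
    intro x hx y
    have hz : ∀ y, HasDerivAt (fun y => w y x) (B x y (w y x) + Bx x y (U x y)) y := by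
      intro y
      have h1 := ((ContinuousMap.evalCLM ℝ (⟨x, hx⟩ : Icc (-R) R)).comp
        (ContinuousLinearMap.snd ℝ F _)).hasFDerivAt.comp_hasDerivAt y (hu y)
      simp only [hw, projIcc_of_mem _ hx]
      exact h1
    have hD : ∀ y, HasDerivAt (fun y => w y x - A x y (U x y))
        (B x y (w y x - A x y (U x y))) y := by
      intro y
      refine ((hz y).sub ((hAy x y).clm_apply (hUy x hx y))).congr_deriv ?_
      have := DFunLike.congr_fun (hcompat x y) (U x y)
      simp only [_root_.add_apply, mul_apply_eq_comp] at this
      rw [this, map_sub]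
      abel
    have hBc : Continuous fun y => B x y := hB.comp (continuous_const.prodMk continuous_id)
    have := linear_ode_solution_unique hBc hD (v := fun _ => 0)
      (fun t => by simpa using hasDerivAt_const t (0 : F)) (by
        simp only [hU0 x hx, hw, projIcc_of_mem _ hx, hu0]
        exact sub_self _)
    exact sub_eq_zero.1 (congr_fun this y)
  exact ⟨U, hUc, fun x hx => ⟨hU0 x hx, fun y =>
    ⟨(hUx x y).congr_deriv (hwA x hx y), hUy x hx y⟩⟩⟩

theorem exists_frobenius_solution [CompleteSpace F]
    (hA : Continuous fun p : ℝ × ℝ => A p.1 p.2) (hB : Continuous fun p : ℝ × ℝ => B p.1 p.2)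
    (hBxc : Continuous fun p : ℝ × ℝ => Bx p.1 p.2)
    (hAy : ∀ x y, HasDerivAt (A x) (Ay x y) y)
    (hBx : ∀ x y, HasDerivAt (fun x' => B x' y) (Bx x y) x)
    (hcompat : ∀ x y, Ay x y + A x y * B x y = Bx x y + B x y * A x y) (u₀ : F) :
    ∃ U : ℝ → ℝ → F, (Continuous fun p : ℝ × ℝ => U p.1 p.2) ∧ U 0 0 = u₀ ∧
      ∀ x y, HasDerivAt (fun x' => U x' y) (A x y (U x y)) x ∧
        HasDerivAt (U x) (B x y (U x y)) y := by
  obtain ⟨V, hV0, hV⟩ := exists_linear_ode_solution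
    (T := fun x => A x 0) (hA.comp (continuous_id.prodMk continuous_const)) u₀
  have hBc : ∀ x, Continuous fun y => B x y := fun x =>
    hB.comp (continuous_const.prodMk continuous_id)
  choose U hU0 hUy using fun x => exists_linear_ode_solution (hBc x) (V x)
  have hloc : ∀ x₀ : ℝ, ∃ W : ℝ → ℝ → F, (Continuous fun p : ℝ × ℝ => W p.1 p.2) ∧
      (∀ᶠ x in nhds x₀, U x = W x) ∧
      ∀ y, HasDerivAt (fun x' => W x' y) (A x₀ y (W x₀ y)) x₀ := by
    intro x₀
    obtain ⟨W, hWc, hW⟩ := exists_local_frobenius_solution hA hB hBxc hAy hBx hcompat hV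
      (R := |x₀| + 1) (by positivity)
    have hmem : Icc (-(|x₀| + 1)) (|x₀| + 1) ∈ nhds x₀ := by
      apply Icc_mem_nhds
      · linarith [neg_abs_le x₀]
      · linarith [le_abs_self x₀]
    refine ⟨W, hWc, ?_, fun y => ((hW x₀ (mem_of_mem_nhds hmem)).2 y).1⟩
    filter_upwards [hmem] with x hx
    exact linear_ode_solution_unique (hBc x) (hUy x) (fun y => ((hW x hx).2 y).2)
      ((hU0 x).trans (hW x hx).1.symm)
  refine ⟨U, ?_, (hU0 0).trans hV0, fun x y => ⟨?_, hUy x y⟩⟩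
  · refine continuous_iff_continuousAt.2 fun p => ?_
    obtain ⟨W, hWc, hUW, -⟩ := hloc p.1
    refine hWc.continuousAt.congr ?_
    filter_upwards [continuousAt_fst.eventually hUW] with q hq
    rw [hq]
  · obtain ⟨W, -, hUW, hWx⟩ := hloc x
    rw [hUW.self_of_nhds]
    exact (hWx y).congr_of_eventuallyEq (hUW.mono fun x' h => by simp only [h])

theorem frobenius_solution_unique
    (hA : Continuous fun p : ℝ × ℝ => A p.1 p.2) (hB : Continuous fun p : ℝ × ℝ => B p.1 p.2)
    {U U' : ℝ → ℝ → F}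
    (hU : ∀ x y, HasDerivAt (fun x' => U x' y) (A x y (U x y)) x ∧
        HasDerivAt (U x) (B x y (U x y)) y)
    (hU' : ∀ x y, HasDerivAt (fun x' => U' x' y) (A x y (U' x y)) x ∧
        HasDerivAt (U' x) (B x y (U' x y)) y)
    (h0 : U 0 0 = U' 0 0) : U = U' := by
  have hx := linear_ode_solution_unique (T := fun x => A x 0)
    (hA.comp (continuous_id.prodMk continuous_const))
    (fun x => (hU x 0).1) (fun x => (hU' x 0).1) h0
  exact funext fun x => linear_ode_solution_unique (T := fun y => B x y)
    (hB.comp (continuous_const.prodMk continuous_id))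
    (fun y => (hU x y).2) (fun y => (hU' x y).2) (congr_fun hx x)

theorem contDiff_of_partial_linear
    (hA : ContDiff ℝ (⊤ : ℕ∞) fun p : ℝ × ℝ => A p.1 p.2)
    (hB : ContDiff ℝ (⊤ : ℕ∞) fun p : ℝ × ℝ => B p.1 p.2) {U : ℝ → ℝ → F}
    (hUc : Continuous fun p : ℝ × ℝ => U p.1 p.2)
    (hU : ∀ x y, HasDerivAt (fun x' => U x' y) (A x y (U x y)) x ∧
        HasDerivAt (U x) (B x y (U x y)) y) :
    ContDiff ℝ (⊤ : ℕ∞) fun p : ℝ × ℝ => U p.1 p.2 := by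
  let f₁ : ℝ → ℝ → ℝ →L[ℝ] F := fun x y => ContinuousLinearMap.toSpanSingleton ℝ (A x y (U x y))
  let f₂ : ℝ → ℝ → ℝ →L[ℝ] F := fun x y => ContinuousLinearMap.toSpanSingleton ℝ (B x y (U x y))
  have hspan : ContDiff ℝ (⊤ : ℕ∞) (ContinuousLinearMap.toSpanSingletonCLE (𝕜 := ℝ) (E := F)) :=
    ContinuousLinearEquiv.contDiff _
  have hfd : ∀ p : ℝ × ℝ, HasFDerivAt (fun p : ℝ × ℝ => U p.1 p.2)
      ((f₁ p.1 p.2).coprod (f₂ p.1 p.2)) p := fun p =>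
    (hasStrictFDerivAt_uncurry_coprod (f := U) (f₁ := f₁) (f₂ := f₂) (u := p)
      (Filter.Eventually.of_forall fun q => (hU q.1 q.2).1.hasFDerivAt)
      (Filter.Eventually.of_forall fun q => (hU q.1 q.2).2.hasFDerivAt)
      (hspan.continuous.comp (hA.continuous.clm_apply hUc)).continuousAt
      (hspan.continuous.comp (hB.continuous.clm_apply hUc)).continuousAt).hasFDerivAt
  refine contDiff_infty.2 fun n => ?_
  induction n with
  | zero => exact contDiff_zero.2 hUc
  | succ n ih =>
    have hn : ((n : ℕ∞) : WithTop ℕ∞) ≤ ((⊤ : ℕ∞) : WithTop ℕ∞) := by exact_mod_cast le_top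
    refine contDiff_succ_iff_hasFDerivAt.2 ⟨_, ?_, hfd⟩
    have h1 : ContDiff ℝ n fun p : ℝ × ℝ => f₁ p.1 p.2 :=
      (hspan.of_le hn).comp ((hA.of_le hn).clm_apply ih)
    have h2 : ContDiff ℝ n fun p : ℝ × ℝ => f₂ p.1 p.2 :=
      (hspan.of_le hn).comp ((hB.of_le hn).clm_apply ih)
    exact (ContinuousLinearMap.coprodEquivL ℝ).contDiff.comp (h1.prodMk h2)

end

/-- A bilinear operation on a finite-dimensional normed space, as a bounded bilinear map for the
topology of the norm. -/
def boundedBilinear {F : Type*} [NormedAddCommGroup F] [NormedSpace ℝ F] [FiniteDimensional ℝ F]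
    (f : F →ₗ[ℝ] F →ₗ[ℝ] F) : F →L[ℝ] F →L[ℝ] F :=
  f.toContinuousBilinearMap

/-- Right multiplication by a matrix, as a bounded bilinear map. -/
def mulRightCLM :=
  boundedBilinear (LinearMap.mul ℝ (Matrix (Fin 2) (Fin 2) ℂ)).flip

theorem mulRightCLM_apply (m u : Matrix (Fin 2) (Fin 2) ℂ) : mulRightCLM m u = u * m := rfl

theorem hasDerivAt_matrix_mul {u v : ℝ → Matrix (Fin 2) (Fin 2) ℂ}
    {u' v' : Matrix (Fin 2) (Fin 2) ℂ} {t : ℝ} (hu : HasDerivAt u u' t) (hv : HasDerivAt v v' t) :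
    HasDerivAt (fun t => u t * v t) (u t * v' + u' * v t) t :=
  (mulRightCLM.hasFDerivAt.comp_hasDerivAt t hv).clm_apply hu

theorem mul_conjTranspose_const {u m : ℝ → Matrix (Fin 2) (Fin 2) ℂ}
    (hu : ∀ t, HasDerivAt u (u t * m t) t) (hm : ∀ t, (m t)ᴴ = -m t) (s t : ℝ) :
    u s * (u s)ᴴ = u t * (u t)ᴴ := by
  have hd : ∀ t, HasDerivAt (fun t => u t * (u t)ᴴ) 0 t := fun t =>
    (hasDerivAt_matrix_mul (hu t) (hu t).star).congr_deriv (by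
      rw [star_eq_conjTranspose, star_eq_conjTranspose, conjTranspose_mul, hm]
      simp [mul_assoc])
  exact is_const_of_deriv_eq_zero (fun t => (hd t).differentiableAt) (fun t => (hd t).deriv) s t

theorem det_const {u m : ℝ → Matrix (Fin 2) (Fin 2) ℂ}
    (hu : ∀ t, HasDerivAt u (u t * m t) t) (hm : ∀ t, (m t).trace = 0) (s t : ℝ) :
    (u s).det = (u t).det := by
  have he : ∀ t i j, HasDerivAt (fun t => u t i j) ((u t * m t) i j) t := fun t i j =>
    hasDerivAt_pi.1 (hasDerivAt_pi.1 (hu t) i) j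
  have hd : ∀ t, HasDerivAt (fun t => (u t).det) 0 t := by
    intro t
    simp only [det_fin_two]
    refine (((he t 0 0).mul (he t 1 1)).sub ((he t 0 1).mul (he t 1 0))).congr_deriv ?_
    have h := hm t
    simp only [trace_fin_two] at h
    simp only [mul_apply, Fin.sum_univ_two]
    linear_combination (u t 0 0 * u t 1 1 - u t 0 1 * u t 1 0) * h
  exact is_const_of_deriv_eq_zero (fun t => (hd t).differentiableAt) (fun t => (hd t).deriv) s t

section

variable (φ : ℝ → ℝ → ℝ) (lam : ℝ) (x y : ℝ)

theorem Aphi_conjTranspose : (Aphi φ lam x y)ᴴ = -Aphi φ lam x y := by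
  ext i j
  fin_cases i <;> fin_cases j <;> simp [Aphi] <;> ring

theorem Bphi_conjTranspose : (Bphi φ lam x y)ᴴ = -Bphi φ lam x y := by
  ext i j
  fin_cases i <;> fin_cases j <;> simp [Bphi, ← Complex.exp_conj] <;> ring

theorem Aphi_trace (lam : ℂ) : (Aphi φ lam x y).trace = 0 := by
  simp [Aphi, trace_fin_two]

theorem Bphi_trace (lam : ℂ) : (Bphi φ lam x y).trace = 0 := by
  simp [Bphi, trace_fin_two]

variable {φ lam}

theorem IsLaxSolution.isSU2 {U : ℝ → ℝ → Matrix (Fin 2) (Fin 2) ℂ}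
    (hU : IsLaxSolution φ lam U) (x y : ℝ) : IsSU2 (U x y) := by
  obtain ⟨-, hd, h0⟩ := hU
  constructor
  · rw [mul_conjTranspose_const (fun t => (hd x t).2) (fun t => Bphi_conjTranspose φ lam x t) y 0,
      mul_conjTranspose_const (fun t => (hd t 0).1) (fun t => Aphi_conjTranspose φ lam t 0) x 0, h0]
    simp
  · rw [det_const (fun t => (hd x t).2) (fun t => Bphi_trace φ x t lam) y 0,
      det_const (fun t => (hd t 0).1) (fun t => Aphi_trace φ t 0 lam) x 0, h0, det_one]

section

variable {Φ : ℝ × ℝ → ℝ}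

theorem hasDerivAt_comp_mk_left {E : Type*} [NormedAddCommGroup E] [NormedSpace ℝ E]
    {f : ℝ × ℝ → E} (hf : Differentiable ℝ f) (x y : ℝ) :
    HasDerivAt (fun x' => f (x', y)) (fderiv ℝ f (x, y) (1, 0)) x :=
  (hf (x, y)).hasFDerivAt.comp_hasDerivAt x ((hasDerivAt_id x).prodMk (hasDerivAt_const x y))

theorem hasDerivAt_comp_mk_right {E : Type*} [NormedAddCommGroup E] [NormedSpace ℝ E]
    {f : ℝ × ℝ → E} (hf : Differentiable ℝ f) (x y : ℝ) :
    HasDerivAt (fun y' => f (x, y')) (fderiv ℝ f (x, y) (0, 1)) y :=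
  (hf (x, y)).hasFDerivAt.comp_hasDerivAt y ((hasDerivAt_const y x).prodMk (hasDerivAt_id y))

theorem contDiff_deriv_left (hΦ : ContDiff ℝ (⊤ : ℕ∞) Φ) :
    ContDiff ℝ (⊤ : ℕ∞) fun p : ℝ × ℝ => deriv (fun x' => Φ (x', p.2)) p.1 := by
  have : (fun p : ℝ × ℝ => deriv (fun x' => Φ (x', p.2)) p.1) = fun p => fderiv ℝ Φ p (1, 0) :=
    funext fun p => (hasDerivAt_comp_mk_left (hΦ.differentiable (by simp)) p.1 p.2).deriv
  rw [this]
  exact (hΦ.fderiv_right (by simp)).clm_apply contDiff_const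

theorem hasDerivAt_deriv_left (hΦ : ContDiff ℝ (⊤ : ℕ∞) Φ) (x y : ℝ) :
    HasDerivAt (fun y' => deriv (fun x' => Φ (x', y')) x)
      (deriv (fun x' => deriv (fun y' => Φ (x', y')) y) x) y := by
  have hd : Differentiable ℝ Φ := hΦ.differentiable (by simp)
  have hd2 : Differentiable ℝ (fderiv ℝ Φ) :=
    (hΦ.fderiv_right (m := (⊤ : ℕ∞)) (by simp)).differentiable (by simp)
  have h1 : ∀ y', deriv (fun x' => Φ (x', y')) x = fderiv ℝ Φ (x, y') (1, 0) := fun y' =>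
    (hasDerivAt_comp_mk_left hd x y').deriv
  have h2 : ∀ x', deriv (fun y' => Φ (x', y')) y = fderiv ℝ Φ (x', y) (0, 1) := fun x' =>
    (hasDerivAt_comp_mk_right hd x' y).deriv
  simp only [h1, h2]
  have h3 := (hasDerivAt_comp_mk_left hd2 x y).clm_apply (hasDerivAt_const x ((0 : ℝ), (1 : ℝ)))
  have h4 := (hasDerivAt_comp_mk_right hd2 x y).clm_apply (hasDerivAt_const y ((1 : ℝ), (0 : ℝ)))
  rw [h3.deriv]
  have hsymm : IsSymmSndFDerivAt ℝ Φ (x, y) := hΦ.contDiffAt.isSymmSndFDerivAt (by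
    simp only [minSmoothness_of_isRCLikeNormedField]
    exact WithTop.coe_le_coe.2 (le_top : (2 : ℕ∞) ≤ ⊤))
  refine h4.congr_deriv ?_
  simp only [map_zero, add_zero]
  exact hsymm _ _

end

theorem Aphi_eq (lam : ℂ) : Aphi φ lam x y =
    ((deriv (fun x' => φ x' y) x : ℝ) : ℂ) • ((I / 2) • !![1, 0; 0, -1])
      + (I / 2) • !![0, -lam; -lam, 0] := by
  ext i j
  fin_cases i <;> fin_cases j <;> simp [Aphi] <;> ring

theorem Bphi_eq (lam : ℂ) : Bphi φ lam x y =
    exp (-I * (φ x y : ℝ)) • ((I / 2) • lam⁻¹ • !![0, 1; 0, 0])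
      + exp (I * (φ x y : ℝ)) • ((I / 2) • lam⁻¹ • !![0, 0; 1, 0]) := by
  ext i j
  fin_cases i <;> fin_cases j <;> simp [Bphi] <;> ring

theorem contDiff_Aphi (hφ : ContDiff ℝ (⊤ : ℕ∞) (fun p : ℝ × ℝ => φ p.1 p.2)) (lam : ℂ) :
    ContDiff ℝ (⊤ : ℕ∞) fun p : ℝ × ℝ => Aphi φ lam p.1 p.2 := by
  simp only [Aphi_eq]
  exact ((ofRealCLM.contDiff.comp (contDiff_deriv_left hφ)).smul contDiff_const).add
    contDiff_const

theorem contDiff_Bphi (hφ : ContDiff ℝ (⊤ : ℕ∞) (fun p : ℝ × ℝ => φ p.1 p.2)) (lam : ℂ) :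
    ContDiff ℝ (⊤ : ℕ∞) fun p : ℝ × ℝ => Bphi φ lam p.1 p.2 := by
  simp only [Bphi_eq]
  have h : ContDiff ℝ (⊤ : ℕ∞) fun p : ℝ × ℝ => ((φ p.1 p.2 : ℝ) : ℂ) :=
    ofRealCLM.contDiff.comp hφ
  exact ((contDiff_const.mul h).cexp.smul contDiff_const).add
    ((contDiff_const.mul h).cexp.smul contDiff_const)

theorem hasDerivAt_Aphi (hφ : ContDiff ℝ (⊤ : ℕ∞) (fun p : ℝ × ℝ => φ p.1 p.2))
    (hsg : ∀ x y : ℝ, deriv (fun x' => deriv (fun y' => φ x' y') y) x = Real.sin (φ x y))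
    (lam : ℂ) :
    HasDerivAt (Aphi φ lam x) (((Real.sin (φ x y) : ℝ) : ℂ) • ((I / 2) • !![1, 0; 0, -1])) y := by
  have h := hasDerivAt_deriv_left hφ x y
  simp only [hsg] at h
  have := (h.ofReal_comp.smul_const
    ((I / 2) • !![1, 0; 0, -1] : Matrix (Fin 2) (Fin 2) ℂ)).add_const ((I / 2) • !![0, -lam; -lam, 0])
  exact this.congr_of_eventuallyEq (Filter.Eventually.of_forall fun y' => Aphi_eq x y' lam)

/-- The partial derivative of `Bphi` in the first variable. -/
def BphiX (φ : ℝ → ℝ → ℝ) (lam : ℂ) (x y : ℝ) : Matrix (Fin 2) (Fin 2) ℂ :=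
  (exp (-I * (φ x y : ℝ)) * (-I * (deriv (fun x' => φ x' y) x : ℝ))) •
      ((I / 2) • lam⁻¹ • !![0, 1; 0, 0])
    + (exp (I * (φ x y : ℝ)) * (I * (deriv (fun x' => φ x' y) x : ℝ))) •
      ((I / 2) • lam⁻¹ • !![0, 0; 1, 0])

theorem hasDerivAt_Bphi (hφ : ContDiff ℝ (⊤ : ℕ∞) (fun p : ℝ × ℝ => φ p.1 p.2)) (lam : ℂ) :
    HasDerivAt (fun x' => Bphi φ lam x' y) (BphiX φ lam x y) x := by
  simp only [Bphi_eq]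
  have h : HasDerivAt (fun x' => φ x' y) (deriv (fun x' => φ x' y) x) x :=
    (hasDerivAt_comp_mk_left (hφ.differentiable (by simp)) x y).differentiableAt.hasDerivAt
  exact ((h.ofReal_comp.const_mul (-I)).cexp.smul_const _).add
    ((h.ofReal_comp.const_mul I).cexp.smul_const _)

theorem continuous_BphiX (hφ : ContDiff ℝ (⊤ : ℕ∞) (fun p : ℝ × ℝ => φ p.1 p.2)) (lam : ℂ) :
    Continuous fun p : ℝ × ℝ => BphiX φ lam p.1 p.2 := by
  have h := hφ.continuous
  have h' := (contDiff_deriv_left hφ).continuous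
  unfold BphiX
  fun_prop

theorem zero_curvature {lam : ℂ} (hlam : lam ≠ 0) :
    ((Real.sin (φ x y) : ℝ) : ℂ) • ((I / 2) • !![1, 0; 0, -1]) + Bphi φ lam x y * Aphi φ lam x y
      = BphiX φ lam x y + Aphi φ lam x y * Bphi φ lam x y := by
  have hs : ((Real.sin (φ x y) : ℝ) : ℂ)
      = (exp (-I * (φ x y : ℝ)) - exp (I * (φ x y : ℝ))) * I / 2 := by
    rw [ofReal_sin, Complex.sin, mul_comm (-I), mul_comm I, neg_mul_comm]
  rw [hs]
  ext i j
  fin_cases i <;> fin_cases j <;>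
    simp [Aphi, Bphi, BphiX] <;> field_simp <;> try ring_nf

theorem IsLaxSolution.unique (hφ : ContDiff ℝ (⊤ : ℕ∞) (fun p : ℝ × ℝ => φ p.1 p.2))
    {U U' : ℝ → ℝ → Matrix (Fin 2) (Fin 2) ℂ}
    (hU : IsLaxSolution φ lam U) (hU' : IsLaxSolution φ lam U') : U = U' := by
  obtain ⟨-, hd, h0⟩ := hU
  obtain ⟨-, hd', h0'⟩ := hU'
  have hA := mulRightCLM.contDiff.comp (contDiff_Aphi hφ lam)
  have hB := mulRightCLM.contDiff.comp (contDiff_Bphi hφ lam)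
  exact frobenius_solution_unique
    (A := fun x y => mulRightCLM (Aphi φ lam x y)) (B := fun x y => mulRightCLM (Bphi φ lam x y))
    hA.continuous hB.continuous hd hd' (h0.trans h0'.symm)

theorem exists_isLaxSolution (hφ : ContDiff ℝ (⊤ : ℕ∞) (fun p : ℝ × ℝ => φ p.1 p.2))
    (hsg : ∀ x y : ℝ, deriv (fun x' => deriv (fun y' => φ x' y') y) x = Real.sin (φ x y))
    (hlam : lam ≠ 0) : ∃ U, IsLaxSolution φ lam U := by
  have hA := mulRightCLM.contDiff.comp (contDiff_Aphi hφ lam)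
  have hB := mulRightCLM.contDiff.comp (contDiff_Bphi hφ lam)
  obtain ⟨U, hUc, hU0, hU⟩ := exists_frobenius_solution
    (A := fun x y => mulRightCLM (Aphi φ lam x y)) (B := fun x y => mulRightCLM (Bphi φ lam x y))
    hA.continuous hB.continuous (mulRightCLM.continuous.comp (continuous_BphiX hφ lam))
    (fun x y => mulRightCLM.hasFDerivAt.comp_hasDerivAt y (hasDerivAt_Aphi x y hφ hsg lam))
    (fun x y => mulRightCLM.hasFDerivAt.comp_hasDerivAt x (hasDerivAt_Bphi x y hφ lam))
    (fun x y => by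
      refine ContinuousLinearMap.ext fun u => ?_
      simp only [_root_.add_apply, mul_apply_eq_comp, mulRightCLM_apply, mul_assoc, ← mul_add]
      rw [zero_curvature x y (ofReal_ne_zero.2 hlam)]) 1
  exact ⟨U, contDiff_of_partial_linear hA hB hUc hU, hU, hU0⟩

end

/-- For a smooth solution `φ` of the sine-Gordon equation and nonzero real `λ`, the Lax
system with initial condition `U(0,0) = I` has a unique smooth solution, and this solution
takes values in SU(2). -/
theorem lax_system_existence_uniqueness_SU2
    (φ : ℝ → ℝ → ℝ) (hφ : ContDiff ℝ (⊤ : ℕ∞) (fun p : ℝ × ℝ => φ p.1 p.2))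
    (hsg : ∀ x y : ℝ, deriv (fun x' => deriv (fun y' => φ x' y') y) x = Real.sin (φ x y))
    (lam : ℝ) (hlam : lam ≠ 0) :
    ∃ U : ℝ → ℝ → Matrix (Fin 2) (Fin 2) ℂ,
      IsLaxSolution φ lam U ∧
      (∀ x y : ℝ, IsSU2 (U x y)) ∧
      (∀ U' : ℝ → ℝ → Matrix (Fin 2) (Fin 2) ℂ, IsLaxSolution φ lam U' → U' = U) := by
  obtain ⟨U, hU⟩ := exists_isLaxSolution hφ hsg hlam
  exact ⟨U, hU, hU.isSU2, fun U' hU' => hU'.unique hφ hU⟩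

end
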